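/- Let d = 4 and define ω : ℝ⁴ → ℝ by ω(x) = √(1 + Σ_{j=1}^{4} 2(1 − cos x_j)). For λ ∈ ℝ and s ∈ ℝ⁴, set J(λ,s) = ∫_{[0,2π]⁴} e^{iλ(ω(x) − s·x)} dx. Then there exists a constant C > 0, independent of λ and s, such that |J(λ,s)| ≤ C(1 + |λ|)^{-3/2} log(2 + |λ|) for all λ ∈ ℝ and all s ∈ ℝ⁴. -/

import Mathlib

open MeasureTheory Real
open scoped ENNReal

noncomputable section

/-- Dispersion relation of the discrete Klein--Gordon equation on `ℤ^d`. -/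
def omegaKG (d : ℕ) (x : Fin d → ℝ) : ℝ :=
  Real.sqrt (1 + ∑ j : Fin d, 2 * (1 - Real.cos (x j)))

/-- The fundamental domain `[0, 2π]^d` of the torus. -/
def cube (d : ℕ) : Set (Fin d → ℝ) := Set.Icc 0 (fun _ => 2 * Real.pi)

/-- The oscillatory integral `J(λ,s) = ∫_{[0,2π]^d} e^{iλ(ω(x) − s·x)} dx`. -/
def oscIntJ (d : ℕ) (lam : ℝ) (s : Fin d → ℝ) : ℂ :=
  ∫ x in cube d,
    Complex.exp (Complex.I * ((lam * (omegaKG d x - ∑ j : Fin d, s j * x j) : ℝ) : ℂ))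

/-- First derivative test of van der Corput. -/
theorem norm_integral_exp_le_of_le_abs_deriv {φ g g' : ℝ → ℝ} {a b μ : ℝ} (hab : a ≤ b)
    (hμ : 0 < μ) (hφ : ∀ x, HasDerivAt φ (g x) x) (hg : ∀ x, HasDerivAt g (g' x) x)
    (hg' : Continuous g') (hpos : ∀ x ∈ Set.Icc a b, 0 ≤ g' x)
    (hle : ∀ x ∈ Set.Icc a b, μ ≤ |g x|) :
    ‖∫ x in a..b, Complex.exp (Complex.I * (φ x : ℂ))‖ ≤ 4 / μ := by
  have hgc : Continuous g := continuous_iff_continuousAt.2 fun x => (hg x).continuousAt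
  have hφc : Continuous φ := continuous_iff_continuousAt.2 fun x => (hφ x).continuousAt
  have hne : ∀ x ∈ Set.uIcc a b, g x ≠ 0 := by
    intro x hx h0
    rw [Set.uIcc_of_le hab] at hx
    have := hle x hx
    rw [h0, abs_zero] at this
    linarith
  have hinv : ∀ x ∈ Set.Icc a b, |(g x)⁻¹| ≤ 1 / μ := by
    intro x hx
    rw [abs_inv, ← one_div]
    exact one_div_le_one_div_of_le hμ (hle x hx)
  have hdinv : ∀ x ∈ Set.uIcc a b, HasDerivAt (fun x => (g x)⁻¹) (-g' x / g x ^ 2) x :=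
    fun x hx => (hg x).inv (hne x hx)
  have hcont : ContinuousOn (fun x => -g' x / g x ^ 2) (Set.uIcc a b) :=
    hg'.neg.continuousOn.div (hgc.pow 2).continuousOn fun x hx => pow_ne_zero _ (hne x hx)
  have hdv : ∀ x ∈ Set.uIcc a b, HasDerivAt
      (fun x => -Complex.I * Complex.exp (Complex.I * (φ x : ℂ)))
      ((g x : ℂ) * Complex.exp (Complex.I * (φ x : ℂ))) x := by
    intro x _
    have h := (((hφ x).ofReal_comp.const_mul Complex.I).cexp).const_mul (-Complex.I)
    refine h.congr_deriv ?_
    linear_combination (-(g x : ℂ) * Complex.exp (Complex.I * (φ x : ℂ))) * Complex.I_mul_I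
  have hparts := intervalIntegral.integral_mul_deriv_eq_deriv_mul
    (fun x hx => (hdinv x hx).ofReal_comp) hdv
    ((Complex.continuous_ofReal.comp_continuousOn hcont).intervalIntegrable)
    (Continuous.intervalIntegrable (by fun_prop) a b)
  have hlhs : ∫ x in a..b, Complex.exp (Complex.I * (φ x : ℂ)) =
      ∫ x in a..b, (((g x)⁻¹ : ℝ) : ℂ) * ((g x : ℂ) * Complex.exp (Complex.I * (φ x : ℂ))) := by
    refine intervalIntegral.integral_congr fun x hx => ?_
    have : (g x : ℂ) ≠ 0 := by exact_mod_cast hne x hx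
    simp only [Complex.ofReal_inv]
    field_simp
  have hterm : ∀ x ∈ Set.Icc a b, ‖(((g x)⁻¹ : ℝ) : ℂ) *
      (-Complex.I * Complex.exp (Complex.I * (φ x : ℂ)))‖ ≤ 1 / μ := by
    intro x hx
    rw [norm_mul, norm_mul, Complex.norm_exp_I_mul_ofReal, norm_neg, Complex.norm_I,
      Complex.norm_real, Real.norm_eq_abs]
    simpa using hinv x hx
  have hint : ‖∫ x in a..b, ((-g' x / g x ^ 2 : ℝ) : ℂ) *
      (-Complex.I * Complex.exp (Complex.I * (φ x : ℂ)))‖ ≤ 2 / μ := by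
    have h1 : ‖∫ x in a..b, ((-g' x / g x ^ 2 : ℝ) : ℂ) *
        (-Complex.I * Complex.exp (Complex.I * (φ x : ℂ)))‖ ≤
        ∫ x in a..b, -(-g' x / g x ^ 2) := by
      refine intervalIntegral.norm_integral_le_of_norm_le hab ?_ hcont.neg.intervalIntegrable
      refine Filter.Eventually.of_forall fun x hx => ?_
      have hx' := Set.Ioc_subset_Icc_self hx
      rw [norm_mul, norm_mul, Complex.norm_exp_I_mul_ofReal, norm_neg, Complex.norm_I,
        Complex.norm_real, Real.norm_eq_abs, abs_of_nonpos]
      · simp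
      · exact div_nonpos_of_nonpos_of_nonneg (by linarith [hpos x hx']) (sq_nonneg _)
    rw [intervalIntegral.integral_neg,
      intervalIntegral.integral_eq_sub_of_hasDerivAt hdinv hcont.intervalIntegrable] at h1
    have ha := abs_le.1 (hinv a ⟨le_rfl, hab⟩)
    have hb := abs_le.1 (hinv b ⟨hab, le_rfl⟩)
    have : 2 / μ = 1 / μ + 1 / μ := by ring
    linarith
  rw [hlhs, hparts]
  have h1 := hterm b ⟨hab, le_rfl⟩
  have h2 := hterm a ⟨le_rfl, hab⟩
  have : 4 / μ = 1 / μ + 1 / μ + 2 / μ := by ring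
  rw [this]
  exact (norm_sub_le _ _).trans (add_le_add ((norm_sub_le _ _).trans (add_le_add h1 h2)) hint)

/-- A monotone function on `[a, b]` is at most `-μ`, of size less than `μ`, and at least `μ`
on three successive intervals. -/
theorem MonotoneOn.exists_threshold {g : ℝ → ℝ} {a b μ : ℝ} (hab : a ≤ b)
    (hg : MonotoneOn g (Set.Icc a b)) :
    ∃ p ∈ Set.Icc a b, (∀ x ∈ Set.Ico a p, g x < μ) ∧ ∀ x ∈ Set.Ioc p b, μ ≤ g x := by
  set S : Set ℝ := insert a {x ∈ Set.Icc a b | g x < μ} with hS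
  have hSb : ∀ x ∈ S, x ≤ b := by
    rintro x (rfl | hx)
    exacts [hab, hx.1.2]
  have hbdd : BddAbove S := ⟨b, hSb⟩
  have haS : a ∈ S := Set.mem_insert _ _
  refine ⟨sSup S, ⟨le_csSup hbdd haS, csSup_le ⟨a, haS⟩ hSb⟩, ?_, ?_⟩
  · rintro x ⟨hax, hx⟩
    obtain ⟨y, hy, hxy⟩ := exists_lt_of_lt_csSup ⟨a, haS⟩ hx
    rcases hy with rfl | hy
    · exact absurd hax (not_le.2 hxy)
    · exact (hg ⟨hax, hxy.le.trans hy.1.2⟩ hy.1 hxy.le).trans_lt hy.2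
  · rintro x ⟨hx, hxb⟩
    by_contra! h
    have hax : a ≤ x := (le_csSup hbdd haS).trans hx.le
    exact absurd (le_csSup hbdd (Set.mem_insert_of_mem _ ⟨⟨hax, hxb⟩, h⟩)) (not_le.2 hx)

/-- Van der Corput estimate for a phase with monotone derivative `g`: if `|g| < μ` only on a set
of diameter at most `ℓ`, the oscillatory integral is at most `ℓ + 8 / μ`. -/
theorem norm_integral_exp_le_add {φ g g' : ℝ → ℝ} {a b μ ℓ : ℝ} (hab : a ≤ b)
    (hμ : 0 < μ) (hℓ : 0 ≤ ℓ) (hφ : ∀ x, HasDerivAt φ (g x) x)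
    (hg : ∀ x, HasDerivAt g (g' x) x)
    (hg' : Continuous g') (hpos : ∀ x ∈ Set.Icc a b, 0 ≤ g' x)
    (hdiam : ∀ x ∈ Set.Icc a b, ∀ y ∈ Set.Icc a b, x < y → |g x| ≤ μ → |g y| ≤ μ → y - x ≤ ℓ) :
    ‖∫ x in a..b, Complex.exp (Complex.I * (φ x : ℂ))‖ ≤ ℓ + 8 / μ := by
  have hgc : Continuous g := continuous_iff_continuousAt.2 fun x => (hg x).continuousAt
  have hφc : Continuous φ := continuous_iff_continuousAt.2 fun x => (hφ x).continuousAt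
  have hmono : MonotoneOn g (Set.Icc a b) := by
    refine monotoneOn_of_deriv_nonneg (convex_Icc a b) hgc.continuousOn
      (fun x _ => (hg x).differentiableAt.differentiableWithinAt) fun x hx => ?_
    rw [(hg x).deriv]
    exact hpos x (interior_subset hx)
  obtain ⟨p, hp, hp1, hp2⟩ := hmono.exists_threshold (μ := -μ) hab
  obtain ⟨q, hq, hq1, hq2⟩ :=
    (hmono.mono (Set.Icc_subset_Icc_left hp.1)).exists_threshold (μ := μ) hp.2
  have hclosed : ∀ {c d : ℝ} {P : ℝ → Prop}, IsClosed {x | P x} → c < d →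
      (∀ x ∈ Set.Ioo c d, P x) → ∀ x ∈ Set.Icc c d, P x := by
    intro c d P hP hcd h x hx
    have : closure (Set.Ioo c d) ⊆ {x | P x} := hP.closure_subset_iff.2 h
    rw [closure_Ioo hcd.ne] at this
    exact this hx
  have hap : ‖∫ x in a..p, Complex.exp (Complex.I * (φ x : ℂ))‖ ≤ 4 / μ := by
    rcases hp.1.eq_or_lt with h | h
    · subst h
      simp only [intervalIntegral.integral_same, norm_zero]
      positivity
    refine norm_integral_exp_le_of_le_abs_deriv hp.1 hμ hφ hg hg'
      (fun x hx => hpos x ⟨hx.1, hx.2.trans hp.2⟩) (hclosed ?_ h fun x hx => ?_)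
    · exact isClosed_le continuous_const hgc.abs
    · have := hp1 x ⟨hx.1.le, hx.2⟩
      exact le_abs.2 (Or.inr (by linarith))
  have hqb : ‖∫ x in q..b, Complex.exp (Complex.I * (φ x : ℂ))‖ ≤ 4 / μ := by
    rcases hq.2.eq_or_lt with h | h
    · subst h
      simp only [intervalIntegral.integral_same, norm_zero]
      positivity
    refine norm_integral_exp_le_of_le_abs_deriv hq.2 hμ hφ hg hg'
      (fun x hx => hpos x ⟨hp.1.trans (hq.1.trans hx.1), hx.2⟩) (hclosed ?_ h fun x hx => ?_)
    · exact isClosed_le continuous_const hgc.abs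
    · exact (hq2 x ⟨hx.1, hx.2.le⟩).trans (le_abs_self _)
  have hpq : ‖∫ x in p..q, Complex.exp (Complex.I * (φ x : ℂ))‖ ≤ ℓ := by
    rcases hq.1.eq_or_lt with h | h
    · subst h
      simpa using hℓ
    have hsmall : ∀ x ∈ Set.Icc p q, |g x| ≤ μ :=
      hclosed (isClosed_le hgc.abs continuous_const) h fun x hx => abs_le.2
        ⟨hp2 x ⟨hx.1, hx.2.le.trans hq.2⟩, (hq1 x ⟨hx.1.le, hx.2⟩).le⟩
    have hlen : q - p ≤ ℓ := hdiam p hp q ⟨hp.1.trans hq.1, hq.2⟩ h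
      (hsmall p ⟨le_rfl, hq.1⟩) (hsmall q ⟨hq.1, le_rfl⟩)
    refine (intervalIntegral.norm_integral_le_of_norm_le_const (C := 1) fun x _ => ?_).trans ?_
    · exact (Complex.norm_exp_I_mul_ofReal _).le
    · rwa [one_mul, abs_of_pos (sub_pos.2 h)]
  have hi : ∀ c d : ℝ, IntervalIntegrable (fun x => Complex.exp (Complex.I * (φ x : ℂ)))
      volume c d := fun c d => Continuous.intervalIntegrable (by fun_prop) c d
  rw [← intervalIntegral.integral_add_adjacent_intervals (hi a p) (hi p b),
    ← intervalIntegral.integral_add_adjacent_intervals (hi p q) (hi q b)]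
  have : ℓ + 8 / μ = 4 / μ + (ℓ + 4 / μ) := by ring
  rw [this]
  exact (norm_add_le _ _).trans (add_le_add hap ((norm_add_le _ _).trans (add_le_add hpq hqb)))

theorem norm_integral_exp_neg (φ : ℝ → ℝ) (a b : ℝ) :
    ‖∫ x in a..b, Complex.exp (Complex.I * ((-φ x : ℝ) : ℂ))‖ =
      ‖∫ x in a..b, Complex.exp (Complex.I * (φ x : ℂ))‖ := by
  rw [← Complex.norm_conj]
  simp only [intervalIntegral, map_sub, ← integral_conj, ← Complex.exp_conj, map_neg,
    map_mul, Complex.conj_I, Complex.conj_ofReal, Complex.ofReal_neg, mul_neg, neg_mul, neg_neg]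

theorem norm_integral_exp_const_add (c : ℝ) (φ : ℝ → ℝ) (a b : ℝ) :
    ‖∫ x in a..b, Complex.exp (Complex.I * ((c + φ x : ℝ) : ℂ))‖ =
      ‖∫ x in a..b, Complex.exp (Complex.I * (φ x : ℂ))‖ := by
  simp only [Complex.ofReal_add, mul_add, Complex.exp_add, intervalIntegral.integral_const_mul,
    norm_mul, Complex.norm_exp_I_mul_ofReal, one_mul]

theorem sub_mul_add_div_five_le_cos_sub_cos {x y : ℝ} (hx : 0 ≤ x) (hxy : x ≤ y)
    (hy : y ≤ π / 2) : (y - x) * (x + y) / 5 ≤ cos x - cos y := by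
  have h1 : 2 / π * ((x + y) / 2) ≤ sin ((x + y) / 2) := mul_le_sin (by linarith) (by linarith)
  have h2 : 2 / π * ((y - x) / 2) ≤ sin ((y - x) / 2) :=
    mul_le_sin (by linarith) (by linarith)
  have hπ : (2 / 5 : ℝ) ≤ (2 / π) * (2 / π) := by
    rw [div_mul_div_comm, div_le_div_iff₀ (by norm_num) (by positivity)]
    nlinarith [pi_lt_d2, pi_pos]
  have h3 : cos x - cos y = 2 * (sin ((x + y) / 2) * sin ((y - x) / 2)) := by
    rw [cos_sub_cos, ← neg_sub y x, neg_div, sin_neg]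
    ring
  have h4 := mul_le_mul h1 h2 (mul_nonneg (by positivity) (by linarith))
    (le_trans (mul_nonneg (by positivity) (by linarith)) h1)
  have h5 := mul_le_mul_of_nonneg_right hπ
    (mul_nonneg (show 0 ≤ (x + y) / 2 by linarith) (show 0 ≤ (y - x) / 2 by linarith))
  rw [h3]
  nlinarith

theorem norm_integral_exp_le_abs_sub (φ : ℝ → ℝ) (a b : ℝ) :
    ‖∫ x in a..b, Complex.exp (Complex.I * (φ x : ℂ))‖ ≤ |b - a| := by
  simpa using intervalIntegral.norm_integral_le_of_norm_le_const (C := 1) (a := a) (b := b)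
    (f := fun x => Complex.exp (Complex.I * (φ x : ℂ)))
    fun x _ => (Complex.norm_exp_I_mul_ofReal _).le

theorem norm_integral_exp_sin_pow_four_le_of_pos {T σ : ℝ} (hT : 0 ≤ T) :
    ‖∫ u in (0 : ℝ)..(π / 2), Complex.exp (Complex.I * ((σ * u - T * sin u : ℝ) : ℂ))‖ ^ 4 *
      (1 + T * |T - σ|) ≤ 200000 := by
  set N := ‖∫ u in (0 : ℝ)..(π / 2),
    Complex.exp (Complex.I * ((σ * u - T * sin u : ℝ) : ℂ))‖ with hN
  have hN0 : 0 ≤ N := norm_nonneg _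
  have hN2 : N ≤ 2 := by
    refine (norm_integral_exp_le_abs_sub _ _ _).trans ?_
    rw [sub_zero, abs_of_pos (by positivity)]
    linarith [pi_lt_d2]
  have hN4 : N ^ 4 ≤ 2 ^ 4 := pow_le_pow_left₀ hN0 hN2 4
  rcases (mul_nonneg hT (abs_nonneg (T - σ))).eq_or_lt with h0 | hpos
  · rw [← h0]
    linarith
  set D := |T - σ| with hD
  have hDpos : 0 < D := pos_of_mul_pos_right hpos hT
  have hTpos : 0 < T := pos_of_mul_pos_left hpos hDpos.le
  obtain ⟨μ, hμ, hμ4⟩ : ∃ μ : ℝ, 0 < μ ∧ μ ^ 4 = T * D := by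
    refine ⟨(T * D) ^ ((1 : ℝ) / 4), by positivity, ?_⟩
    rw [← rpow_natCast, ← rpow_mul hpos.le]
    norm_num
  have hmain : N ≤ 10 / μ + 8 / μ := by
    refine norm_integral_exp_le_add (g := fun u => σ - T * cos u) (g' := fun u => T * sin u)
      (by positivity) hμ (by positivity) ?_ ?_ (by fun_prop) ?_ ?_
    · intro u
      refine ((hasDerivAt_id u).const_mul σ |>.sub ((hasDerivAt_sin u).const_mul T)).congr_deriv ?_
      ring
    · intro u
      refine (((hasDerivAt_cos u).const_mul T).const_sub σ).congr_deriv ?_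
      ring
    · exact fun u hu => mul_nonneg hT (sin_nonneg_of_mem_Icc ⟨hu.1, by linarith [hu.2, pi_pos]⟩)
    · intro x hx y hy hxy hgx hgy
      have hx0 := hx.1
      rw [le_div_iff₀ hμ]
      have hsq : ((y - x) * μ) ^ 2 ≤ 10 ^ 2 := by
        have hyx : 0 < y - x := sub_pos.2 hxy
        suffices h : (y - x) ^ 2 * μ ^ 4 ≤ 100 * μ ^ 2 by
          have : (y - x) ^ 2 * μ ^ 2 * μ ^ 2 ≤ 100 * μ ^ 2 := by linarith
          have := le_of_mul_le_mul_right this (by positivity)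
          linarith
        rw [hμ4]
        have hgx' := abs_le.1 hgx
        have hgy' := abs_le.1 hgy
        rcases le_total (T * y ^ 2) D with h | h
        · have hcos : 1 - cos y ≤ y ^ 2 / 2 := by
            linarith [one_sub_sq_div_two_le_cos (x := y)]
          have h1 : D ≤ |σ - T * cos y| + T * (1 - cos y) := by
            rw [hD, abs_sub_comm]
            have h1 := abs_sub (σ - T * cos y) (T * (1 - cos y))
            rw [abs_of_nonneg (mul_nonneg hT (sub_nonneg.2 (cos_le_one y)))] at h1
            rwa [show σ - T * cos y - T * (1 - cos y) = σ - T by ring] at h1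
          have h2 : T * (1 - cos y) ≤ T * (y ^ 2 / 2) := by gcongr
          have h3 : D ≤ 2 * μ := by linarith
          have h4 : (y - x) ^ 2 ≤ y ^ 2 := by nlinarith
          calc (y - x) ^ 2 * (T * D) ≤ y ^ 2 * (T * D) := by gcongr
            _ = (T * y ^ 2) * D := by ring
            _ ≤ D * D := by gcongr
            _ ≤ (2 * μ) * (2 * μ) := by gcongr
            _ ≤ 100 * μ ^ 2 := by nlinarith [sq_nonneg μ]
        · have h1 := sub_mul_add_div_five_le_cos_sub_cos hx0 hxy.le hy.2
          have h2 := mul_le_mul_of_nonneg_left h1 hT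
          have h3 : T * ((y - x) * y) ≤ 10 * μ := by
            have : 0 ≤ T * ((y - x) * x) := by positivity
            nlinarith
          have hy0 : 0 < y := hx0.trans_lt hxy
          calc (y - x) ^ 2 * (T * D) ≤ (y - x) ^ 2 * (T * (T * y ^ 2)) := by gcongr
            _ = (T * ((y - x) * y)) ^ 2 := by ring
            _ ≤ (10 * μ) ^ 2 := by gcongr
            _ = 100 * μ ^ 2 := by ring
      exact le_of_sq_le_sq hsq (by norm_num)
  have h18 : N * μ ≤ 18 := by
    rw [← add_div, le_div_iff₀ hμ] at hmain
    linarith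
  have : (N * μ) ^ 4 ≤ 18 ^ 4 := pow_le_pow_left₀ (by positivity) h18 4
  rw [mul_pow, hμ4] at this
  linarith

theorem norm_integral_exp_sin_pow_four_le (T σ : ℝ) :
    ‖∫ u in (0 : ℝ)..(π / 2), Complex.exp (Complex.I * ((σ * u - T * sin u : ℝ) : ℂ))‖ ^ 4 ≤
      200000 * (1 + |T| * |T - σ|)⁻¹ := by
  rw [← div_eq_mul_inv, le_div_iff₀ (by positivity)]
  rcases le_total 0 T with hT | hT
  · rw [abs_of_nonneg hT]
    exact norm_integral_exp_sin_pow_four_le_of_pos hT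
  · rw [← norm_integral_exp_neg, abs_of_nonpos hT, abs_sub_comm,
      show σ - T = -T - -σ by ring]
    have h := norm_integral_exp_sin_pow_four_le_of_pos (T := -T) (σ := -σ) (by linarith)
    simp only [show ∀ u, -σ * u - -T * sin u = -(σ * u - T * sin u) from fun u => by ring] at h
    exact h

/-- Uniform bound for the one-dimensional oscillatory integral with phase `-T cos x - σ x`. -/
theorem norm_integral_exp_cos_pow_four_le (T σ : ℝ) :
    ‖∫ x in (0 : ℝ)..(2 * π), Complex.exp (Complex.I * ((-T * cos x - σ * x : ℝ) : ℂ))‖ ^ 4 ≤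
      25600000 * ((1 + |T| * |T - σ|)⁻¹ + (1 + |T| * |T + σ|)⁻¹) := by
  set f : ℝ → ℂ := fun x => Complex.exp (Complex.I * ((-T * cos x - σ * x : ℝ) : ℂ)) with hf
  have hi : ∀ c d : ℝ, IntervalIntegrable f volume c d :=
    fun c d => Continuous.intervalIntegrable (by fun_prop) c d
  set L : ℝ → ℝ := fun T => ‖∫ u in (0 : ℝ)..(π / 2),
    Complex.exp (Complex.I * ((σ * u - T * sin u : ℝ) : ℂ))‖ with hL
  have h1 : ‖∫ x in (0 : ℝ)..(π / 2), f x‖ = L T := by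
    have := intervalIntegral.integral_comp_sub_left f (a := 0) (b := π / 2) (π / 2)
    rw [sub_self, sub_zero] at this
    rw [← this]
    refine Eq.trans ?_ (norm_integral_exp_const_add (-(σ * (π / 2))) _ _ _)
    congr 2
    ext u
    simp only [hf, cos_pi_div_two_sub]
    congr 3
    ring
  have h2 : ‖∫ x in (π / 2)..π, f x‖ = L T := by
    have := intervalIntegral.integral_comp_add_left f (a := 0) (b := π / 2) (π / 2)
    rw [add_zero, add_halves] at this
    rw [← this]
    refine Eq.trans ?_ ((norm_integral_exp_const_add (-(σ * (π / 2))) _ _ _).trans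
      (norm_integral_exp_neg _ _ _))
    congr 2
    ext u
    simp only [hf, add_comm (π / 2) u, cos_add_pi_div_two]
    congr 3
    ring
  have h3 : ‖∫ x in π..(3 * π / 2), f x‖ = L (-T) := by
    have := intervalIntegral.integral_comp_sub_left f (a := 0) (b := π / 2) (3 * π / 2)
    rw [sub_zero, show 3 * π / 2 - π / 2 = π by ring] at this
    rw [← this]
    refine Eq.trans ?_ (norm_integral_exp_const_add (-(σ * (3 * π / 2))) _ _ _)
    congr 2
    ext u
    simp only [hf, show 3 * π / 2 - u = (π / 2 - u) + π by ring, cos_add_pi, cos_pi_div_two_sub]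
    congr 3
    ring
  have h4 : ‖∫ x in (3 * π / 2)..(2 * π), f x‖ = L (-T) := by
    have := intervalIntegral.integral_comp_add_left f (a := 0) (b := π / 2) (3 * π / 2)
    rw [add_zero, show 3 * π / 2 + π / 2 = 2 * π by ring] at this
    rw [← this]
    refine Eq.trans ?_ ((norm_integral_exp_const_add (-(σ * (3 * π / 2))) _ _ _).trans
      (norm_integral_exp_neg _ _ _))
    congr 2
    ext u
    simp only [hf, show 3 * π / 2 + u = (u + π / 2) + π by ring, cos_add_pi, cos_add_pi_div_two]
    congr 3
    ring
  have hsum : ‖∫ x in (0 : ℝ)..(2 * π), f x‖ ≤ 2 * (L T + L (-T)) := by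
    rw [← intervalIntegral.integral_add_adjacent_intervals (hi 0 (π / 2)) (hi _ _),
      ← intervalIntegral.integral_add_adjacent_intervals (hi (π / 2) π) (hi _ _),
      ← intervalIntegral.integral_add_adjacent_intervals (hi π (3 * π / 2)) (hi _ _)]
    refine (norm_add_le _ _).trans ?_
    rw [h1]
    have h5 := norm_add_le (∫ x in (π / 2)..π, f x)
      ((∫ x in π..(3 * π / 2), f x) + ∫ x in (3 * π / 2)..(2 * π), f x)
    have h6 := norm_add_le (∫ x in π..(3 * π / 2), f x) (∫ x in (3 * π / 2)..(2 * π), f x)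
    linarith
  have hL0 : ∀ T, 0 ≤ L T := fun T => norm_nonneg _
  have hLT := norm_integral_exp_sin_pow_four_le T σ
  have hLT' := norm_integral_exp_sin_pow_four_le (-T) σ
  rw [abs_neg, ← abs_neg (-T - σ), neg_sub', neg_neg, sub_neg_eq_add] at hLT'
  calc ‖∫ x in (0 : ℝ)..(2 * π), f x‖ ^ 4 ≤ (2 * (L T + L (-T))) ^ 4 := by gcongr
    _ = 16 * (L T + L (-T)) ^ 4 := by ring
    _ ≤ 16 * (2 ^ 3 * (L T ^ 4 + L (-T) ^ 4)) := by
      gcongr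
      exact add_pow_le (hL0 _) (hL0 _) 4
    _ ≤ 16 * (2 ^ 3 * (200000 * (1 + |T| * |T - σ|)⁻¹ + 200000 * (1 + |T| * |T + σ|)⁻¹)) := by
      gcongr
    _ = _ := by ring

/-- Passing from the pure oscillatory integral to one with a `C¹` amplitude. -/
theorem norm_integral_mul_exp_le {φ f f' : ℝ → ℝ} {a b B : ℝ} (hab : a ≤ b)
    (hφ : Continuous φ) (hf : ∀ x, HasDerivAt f (f' x) x) (hf' : Continuous f')
    (hB : ∀ y ∈ Set.Icc a b, ‖∫ x in a..y, Complex.exp (Complex.I * (φ x : ℂ))‖ ≤ B) :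
    ‖∫ x in a..b, (f x : ℂ) * Complex.exp (Complex.I * (φ x : ℂ))‖ ≤
      (|f b| + ∫ x in a..b, |f' x|) * B := by
  have hc : Continuous fun x => Complex.exp (Complex.I * (φ x : ℂ)) := by fun_prop
  have hparts := intervalIntegral.integral_mul_deriv_eq_deriv_mul (a := a) (b := b)
    (fun x _ => (hf x).ofReal_comp)
    (fun x _ => (hc.integral_hasStrictDerivAt a x).hasDerivAt)
    (Continuous.intervalIntegrable (by fun_prop) a b) (hc.intervalIntegrable a b)
  rw [hparts, intervalIntegral.integral_same, mul_zero, sub_zero, add_mul]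
  refine (norm_sub_le _ _).trans (add_le_add ?_ ?_)
  · rw [norm_mul, Complex.norm_real, Real.norm_eq_abs]
    gcongr
    exact hB b ⟨hab, le_rfl⟩
  · rw [← intervalIntegral.integral_mul_const]
    refine intervalIntegral.norm_integral_le_of_norm_le hab
      (Filter.Eventually.of_forall fun x hx => ?_)
      (Continuous.intervalIntegrable (by fun_prop) a b)
    rw [norm_mul, Complex.norm_real, Real.norm_eq_abs]
    gcongr
    exact hB x (Set.Ioc_subset_Icc_self hx)

theorem norm_integral_exp_quadratic_le (lam : ℝ) {T a b : ℝ} (hab : a ≤ b) (hT : T ≠ 0) :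
    ‖∫ y in a..b, Complex.exp (Complex.I * ((lam * y - T / 2 * y ^ 2 : ℝ) : ℂ))‖ ≤
      10 / √|T| := by
  wlog hneg : T < 0 generalizing T lam
  · have h := this (-lam) (T := -T) (neg_ne_zero.2 hT)
      (neg_lt_zero.2 (lt_of_le_of_ne (not_lt.1 hneg) hT.symm))
    rw [abs_neg] at h
    rw [← norm_integral_exp_neg]
    simp only [show ∀ y, -lam * y - -T / 2 * y ^ 2 = -(lam * y - T / 2 * y ^ 2) from
      fun y => by ring] at h
    exact h
  have hμ : 0 < √|T| := Real.sqrt_pos.2 (abs_pos.2 hT)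
  have hμ2 : √|T| * √|T| = -T := by rw [Real.mul_self_sqrt (abs_nonneg T), abs_of_neg hneg]
  have : 10 / √|T| = 2 / √|T| + 8 / √|T| := by ring
  rw [this]
  refine norm_integral_exp_le_add (g := fun y => lam - T * y) (g' := fun _ => -T) hab hμ
    (by positivity) (fun y => ?_) (fun y => ?_) continuous_const (fun _ _ => by linarith) ?_
  · refine (((hasDerivAt_id y).const_mul lam).sub
      ((hasDerivAt_pow 2 y).const_mul (T / 2))).congr_deriv ?_
    norm_num
    ring
  · refine (((hasDerivAt_id y).const_mul T).const_sub lam).congr_deriv ?_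
    simp
  · intro x _ y _ hxy hx hy
    have hx' := abs_le.1 hx
    have hy' := abs_le.1 hy
    rw [le_div_iff₀ hμ]
    refine le_of_mul_le_mul_right ?_ hμ
    rw [mul_assoc, hμ2]
    linarith

/-- The oscillatory integral `∫ f(y) e^{i(λ y - T y² / 2)} dy` over `[0, 5]`. -/
def quadOsc (f : ℝ → ℝ) (lam T : ℝ) : ℂ :=
  ∫ y in (0 : ℝ)..5, (f y : ℂ) *
    Complex.exp (Complex.I * ((lam * y - T / 2 * y ^ 2 : ℝ) : ℂ))

theorem exists_norm_quadOsc_le {f : ℝ → ℝ} (hf : ContDiff ℝ 1 f) :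
    ∃ A, 0 ≤ A ∧ ∀ lam T, ‖quadOsc f lam T‖ ≤ A ∧ ‖quadOsc f lam T‖ * √|T| ≤ A := by
  have hc : Continuous (deriv f) := hf.continuous_deriv le_rfl
  have hd : ∀ x, HasDerivAt f (deriv f x) x := fun x =>
    (hf.differentiable one_ne_zero x).hasDerivAt
  set V := |f 5| + ∫ x in (0 : ℝ)..5, |deriv f x| with hV
  have hV0 : 0 ≤ V := add_nonneg (abs_nonneg _)
    (intervalIntegral.integral_nonneg (by norm_num) fun _ _ => abs_nonneg _)
  refine ⟨V * 10, by positivity, fun lam T => ⟨?_, ?_⟩⟩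
  · refine norm_integral_mul_exp_le (by norm_num) (by fun_prop) hd hc fun y hy => ?_
    refine (norm_integral_exp_le_abs_sub _ _ _).trans ?_
    rw [sub_zero, abs_of_nonneg hy.1]
    linarith [hy.2]
  · rcases eq_or_ne T 0 with rfl | hT
    · simp only [abs_zero, Real.sqrt_zero, mul_zero]
      positivity
    · rw [← le_div_iff₀ (Real.sqrt_pos.2 (abs_pos.2 hT)), mul_div_assoc]
      exact norm_integral_mul_exp_le (by norm_num) (by fun_prop) hd hc
        fun y hy => norm_integral_exp_quadratic_le lam hy.1 hT

theorem sq_mul_quadOsc {f : ℝ → ℝ} (hf : ContDiff ℝ 2 f) (h0 : f 0 = 0) (h5 : f 5 = 0)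
    (hd0 : deriv f 0 = 0) (hd5 : deriv f 5 = 0) (lam T : ℝ) :
    (lam : ℂ) ^ 2 * quadOsc f lam T = -quadOsc (deriv (deriv f)) lam T +
      Complex.I * T * quadOsc (fun y => f y + 2 * y * deriv f y) lam T +
      (T : ℂ) ^ 2 * quadOsc (fun y => y ^ 2 * f y) lam T := by
  have hf1 : ContDiff ℝ 1 (deriv f) := (contDiff_succ_iff_deriv.1 hf).2.2
  have hc0 : Continuous f := hf.continuous
  have hc1 : Continuous (deriv f) := hf1.continuous
  have hc2 : Continuous (deriv (deriv f)) := hf1.continuous_deriv le_rfl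
  have hd : ∀ x, HasDerivAt f (deriv f x) x := fun x =>
    (hf.differentiable two_ne_zero x).hasDerivAt
  have hdd : ∀ x, HasDerivAt (deriv f) (deriv (deriv f) x) x := fun x =>
    (hf1.differentiable one_ne_zero x).hasDerivAt
  set E : ℝ → ℂ := fun y => Complex.exp (Complex.I * ((lam * y - T / 2 * y ^ 2 : ℝ) : ℂ)) with hE
  have hEc : Continuous E := by fun_prop
  have hEd : ∀ y, HasDerivAt E (E y * (Complex.I * ((lam - T * y : ℝ) : ℂ))) y := by
    intro y
    have h : HasDerivAt (fun y : ℝ => lam * y - T / 2 * y ^ 2) (lam - T * y) y := by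
      refine (((hasDerivAt_id y).const_mul lam).sub
        ((hasDerivAt_pow 2 y).const_mul (T / 2))).congr_deriv ?_
      norm_num
      ring
    exact (h.ofReal_comp.const_mul Complex.I).cexp
  have hF : ∀ y, HasDerivAt
      (fun y : ℝ => (((deriv f y : ℝ) : ℂ) - Complex.I * ((lam + T * y : ℝ) : ℂ) * (f y : ℂ)) * E y)
      ((lam : ℂ) ^ 2 * ((f y : ℂ) * E y) + ((deriv (deriv f) y : ℝ) : ℂ) * E y -
        Complex.I * T * (((f y + 2 * y * deriv f y : ℝ) : ℂ) * E y) -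
        (T : ℂ) ^ 2 * (((y ^ 2 * f y : ℝ) : ℂ) * E y)) y := by
    intro y
    have h : HasDerivAt (fun y : ℝ => lam + T * y) T y := by
      simpa using ((hasDerivAt_id y).const_mul T).const_add lam
    refine (((hdd y).ofReal_comp.sub
      ((h.ofReal_comp.const_mul Complex.I).mul (hd y).ofReal_comp)).mul (hEd y)).congr_deriv ?_
    simp only [Pi.sub_apply, Pi.mul_apply]
    push_cast
    linear_combination (-((lam : ℂ) ^ 2 - (T : ℂ) ^ 2 * y ^ 2) * f y * E y) * Complex.I_sq
  have hint := intervalIntegral.integral_eq_sub_of_hasDerivAt (a := 0) (b := 5)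
    (fun y _ => hF y) (Continuous.intervalIntegrable (by fun_prop) _ _)
  have hii : ∀ g : ℝ → ℂ, Continuous g → IntervalIntegrable g volume (0 : ℝ) 5 :=
    fun g hg => hg.intervalIntegrable _ _
  rw [intervalIntegral.integral_sub (hii _ (by fun_prop)) (hii _ (by fun_prop)),
    intervalIntegral.integral_sub (hii _ (by fun_prop)) (hii _ (by fun_prop)),
    intervalIntegral.integral_add (hii _ (by fun_prop)) (hii _ (by fun_prop)),
    intervalIntegral.integral_const_mul, intervalIntegral.integral_const_mul,
    intervalIntegral.integral_const_mul, h0, h5, hd0, hd5] at hint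
  simp only [quadOsc]
  simp only [Complex.ofReal_zero, mul_zero, sub_zero, zero_mul] at hint
  linear_combination hint

theorem exists_quadOsc_decay {f : ℝ → ℝ} (hf : ContDiff ℝ 3 f) (h0 : f 0 = 0) (h5 : f 5 = 0)
    (hd0 : deriv f 0 = 0) (hd5 : deriv f 5 = 0) :
    ∃ A, 0 ≤ A ∧ ∀ lam T, ‖quadOsc f lam T‖ * √|T| ≤ A ∧
      (|T| ≤ 1 → lam ^ 2 * ‖quadOsc f lam T‖ ≤ A) ∧
      (1 ≤ |T| → lam ^ 2 * (‖quadOsc f lam T‖ * √|T|) ≤ A * T ^ 2) := by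
  have hf1 : ContDiff ℝ 2 (deriv f) := (contDiff_succ_iff_deriv.1 hf).2.2
  have hf2 : ContDiff ℝ 1 (deriv (deriv f)) := (contDiff_succ_iff_deriv.1 hf1).2.2
  have hf' : ContDiff ℝ 1 f := hf.of_le (by norm_num)
  have hf1' : ContDiff ℝ 1 (deriv f) := hf1.of_le (by norm_num)
  obtain ⟨A0, hA0, h⟩ := exists_norm_quadOsc_le hf'
  obtain ⟨A1, hA1, h1⟩ := exists_norm_quadOsc_le hf2
  obtain ⟨A2, hA2, h2⟩ := exists_norm_quadOsc_le (f := fun y => f y + 2 * y * deriv f y)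
    (by fun_prop)
  obtain ⟨A3, hA3, h3⟩ := exists_norm_quadOsc_le (f := fun y => y ^ 2 * f y) (by fun_prop)
  refine ⟨A0 + A1 + A2 + A3, by positivity, fun lam T => ?_⟩
  have key : lam ^ 2 * ‖quadOsc f lam T‖ ≤ ‖quadOsc (deriv (deriv f)) lam T‖ +
      |T| * ‖quadOsc (fun y => f y + 2 * y * deriv f y) lam T‖ +
      |T| ^ 2 * ‖quadOsc (fun y => y ^ 2 * f y) lam T‖ := by
    have := congrArg norm (sq_mul_quadOsc (hf.of_le (by norm_num)) h0 h5 hd0 hd5 lam T)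
    rw [norm_mul, norm_pow, Complex.norm_real, Real.norm_eq_abs, sq_abs] at this
    rw [this]
    refine norm_add₃_le.trans (le_of_eq ?_)
    simp only [norm_neg, norm_mul, norm_pow, Complex.norm_real, Real.norm_eq_abs, Complex.norm_I,
      one_mul]
  refine ⟨by linarith [(h lam T).2], fun hT => ?_, fun hT => ?_⟩
  · have e2 := mul_le_mul hT (h2 lam T).1 (norm_nonneg _) zero_le_one
    have e3 := mul_le_mul (pow_le_one₀ (n := 2) (abs_nonneg T) hT) (h3 lam T).1 (norm_nonneg _)
      zero_le_one
    linarith [(h1 lam T).1]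
  · have e := mul_le_mul_of_nonneg_right key (Real.sqrt_nonneg |T|)
    have hT2 : |T| ≤ |T| ^ 2 := by nlinarith
    have e1 : ‖quadOsc (deriv (deriv f)) lam T‖ * √|T| ≤ |T| ^ 2 * A1 := by
      nlinarith [(h1 lam T).2]
    have e2 := mul_le_mul hT2 (h2 lam T).2 (by positivity) (by positivity)
    have e3 := mul_le_mul_of_nonneg_left (h3 lam T).2 (sq_nonneg |T|)
    have e0 : 0 ≤ |T| ^ 2 * A0 := by positivity
    rw [← sq_abs T]
    linarith

theorem Real.rpow_neg_three_halves {t : ℝ} (ht : 0 ≤ t) :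
    t ^ (-(3 : ℝ) / 2) = (√t ^ 3)⁻¹ := by
  rw [neg_div, rpow_neg ht, sqrt_eq_rpow, ← rpow_natCast, ← rpow_mul ht]
  norm_num

/-- The tail `r⁻² t^{-3/2}` on `(r², ∞)`. -/
theorem tail_majorant {r : ℝ} (hr : 0 < r) :
    Integrable (Set.indicator (Set.Ioi (r ^ 2)) fun t : ℝ => (r ^ 2)⁻¹ * t ^ (-(3 : ℝ) / 2)) ∧
      ∫ t, Set.indicator (Set.Ioi (r ^ 2)) (fun t : ℝ => (r ^ 2)⁻¹ * t ^ (-(3 : ℝ) / 2)) t =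
        2 / r ^ 3 := by
  have hr2 : 0 < r ^ 2 := by positivity
  constructor
  · exact IntegrableOn.integrable_indicator
      ((integrableOn_Ioi_rpow_of_lt (by norm_num) hr2).const_mul _) measurableSet_Ioi
  · rw [integral_indicator measurableSet_Ioi, integral_const_mul,
      integral_Ioi_rpow_of_lt (by norm_num) hr2,
      show (-(3 : ℝ) / 2 + 1) = -(1 / 2) by norm_num, rpow_neg hr2.le, ← sqrt_eq_rpow,
      Real.sqrt_sq hr.le]
    field_simp

/-- The logarithmic piece `r⁻³ / (r⁻² + t)` on `[0, r²]`. -/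
theorem log_majorant {r : ℝ} (hr : 0 < r) :
    Integrable (Set.indicator (Set.Icc 0 (r ^ 2)) fun t : ℝ => (r ^ 3)⁻¹ * ((r ^ 2)⁻¹ + t)⁻¹) ∧
      ∫ t, Set.indicator (Set.Icc 0 (r ^ 2)) (fun t : ℝ => (r ^ 3)⁻¹ * ((r ^ 2)⁻¹ + t)⁻¹) t =
        log (1 + r ^ 4) / r ^ 3 := by
  have hr2 : 0 < r ^ 2 := by positivity
  have hpos : ∀ t ∈ Set.uIcc 0 (r ^ 2), (r ^ 2)⁻¹ + t ≠ 0 := by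
    intro t ht
    rw [Set.uIcc_of_le hr2.le] at ht
    have := ht.1
    positivity
  have hcont : ContinuousOn (fun t : ℝ => (r ^ 3)⁻¹ * ((r ^ 2)⁻¹ + t)⁻¹)
      (Set.uIcc 0 (r ^ 2)) :=
    continuousOn_const.mul ((continuousOn_const.add continuousOn_id).inv₀ hpos)
  constructor
  · refine IntegrableOn.integrable_indicator ?_ measurableSet_Icc
    exact (intervalIntegrable_iff_integrableOn_Icc_of_le hr2.le).1 hcont.intervalIntegrable
  · rw [integral_indicator measurableSet_Icc, integral_Icc_eq_integral_Ioc,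
      ← intervalIntegral.integral_of_le hr2.le,
      intervalIntegral.integral_eq_sub_of_hasDerivAt
        (f := fun t => (r ^ 3)⁻¹ * log ((r ^ 2)⁻¹ + t)) ?_ hcont.intervalIntegrable]
    · rw [← mul_sub, add_zero, ← log_div (by positivity) (by positivity)]
      rw [show ((r ^ 2)⁻¹ + r ^ 2) / (r ^ 2)⁻¹ = 1 + r ^ 4 by field_simp]
      ring
    · intro t ht
      refine ((((hasDerivAt_id t).const_add (r ^ 2)⁻¹).log (hpos t ht)).const_mul _).congr_deriv ?_
      simp

/-- A function with the decay of a Fourier transform of `e^{i r² √A}` has integral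
`O(r⁻³ log r)` against `1 / (1 + |T| |T - σ|)`, uniformly in `σ`. -/
theorem exists_integrable_majorant {r A : ℝ} (hr : 1 ≤ r) (hA : 0 ≤ A) {N : ℝ → ℝ}
    (hN : ∀ T, 0 ≤ N T) (h1 : ∀ T, N T * √|T| ≤ A) (h2 : ∀ T, |T| ≤ 1 → r ^ 4 * N T ≤ A)
    (h3 : ∀ T, 1 ≤ |T| → r ^ 4 * (N T * √|T|) ≤ A * T ^ 2) (σ : ℝ) :
    ∃ M : ℝ → ℝ, Integrable M ∧ ∫ T, M T ≤ A * (12 * log (2 + r ^ 2) / r ^ 3) ∧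
      ∀ T, N T * (1 + |T| * |T - σ|)⁻¹ ≤ M T := by
  have hr0 : 0 < r := by linarith
  obtain ⟨hfi, hfv⟩ := tail_majorant hr0
  obtain ⟨hki, hkv⟩ := log_majorant hr0
  set f := Set.indicator (Set.Ioi (r ^ 2)) fun t : ℝ => (r ^ 2)⁻¹ * t ^ (-(3 : ℝ) / 2) with hf
  set k := Set.indicator (Set.Icc 0 (r ^ 2)) fun t : ℝ => (r ^ 3)⁻¹ * ((r ^ 2)⁻¹ + t)⁻¹ with hk
  have hf0 : ∀ t, 0 ≤ f t := fun t => Set.indicator_nonneg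
    (fun t ht => by have : 0 < t := (by positivity : 0 < r ^ 2).trans ht; positivity) t
  have hk0 : ∀ t, 0 ≤ k t := fun t => Set.indicator_nonneg
    (fun t ht => by have := ht.1; positivity) t
  have hcst : ∀ {b c : ℝ}, 0 ≤ b →
      Integrable (Set.indicator (Set.Icc (-b) b) fun _ : ℝ => c) ∧
      ∫ t, Set.indicator (Set.Icc (-b) b) (fun _ : ℝ => c) t = 2 * b * c := by
    intro b c hb
    refine ⟨(integrableOn_const (by simp)).integrable_indicator measurableSet_Icc, ?_⟩
    rw [integral_indicator measurableSet_Icc, setIntegral_const, measureReal_def, Real.volume_Icc,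
      ENNReal.toReal_ofReal (by linarith), smul_eq_mul]
    ring
  obtain ⟨hai, hav⟩ := hcst (b := 1) (c := (r ^ 4)⁻¹) zero_le_one
  obtain ⟨hbi, hbv⟩ := hcst (b := r ^ 2) (c := (r ^ 5)⁻¹) (by positivity)
  set a := Set.indicator (Set.Icc (-1 : ℝ) 1) fun _ : ℝ => (r ^ 4)⁻¹ with ha
  set b := Set.indicator (Set.Icc (-r ^ 2) (r ^ 2)) fun _ : ℝ => (r ^ 5)⁻¹ with hb
  have ha0 : ∀ t, 0 ≤ a t := fun t => Set.indicator_nonneg (fun _ _ => by positivity) t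
  have hb0 : ∀ t, 0 ≤ b t := fun t => Set.indicator_nonneg (fun _ _ => by positivity) t
  have hfi' : Integrable fun t => f (-t) := hfi.comp_neg
  have hki' : Integrable fun t => k (t - σ) := hki.comp_sub_right σ
  have hki'' : Integrable fun t => k (σ - t) := hki.comp_sub_left σ
  have hf_abs : ∀ T, f |T| ≤ f T + f (-T) := fun T => by
    rcases abs_cases T with h | h <;> rw [h.1] <;> linarith [hf0 T, hf0 (-T)]
  have hk_abs : ∀ T, k |T - σ| ≤ k (T - σ) + k (σ - T) := fun T => by
    rcases abs_cases (T - σ) with h | h <;> rw [h.1] <;> try rw [neg_sub]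
    all_goals linarith [hk0 (T - σ), hk0 (σ - T)]
  have hab : Integrable fun t => a t + b t := hai.add hbi
  have hff : Integrable fun t => f t + f (-t) := hfi.add hfi'
  have hkk : Integrable fun t => k (t - σ) + k (σ - t) := hki'.add hki''
  have habf : Integrable fun t => (a t + b t) + (f t + f (-t)) := hab.add hff
  refine ⟨fun T => A * ((a T + b T) + (f T + f (-T)) + (k (T - σ) + k (σ - T))),
    (habf.add hkk).const_mul A, ?_, fun T => ?_⟩
  · rw [integral_const_mul]
    gcongr
    rw [integral_add habf hkk,
      integral_add hab hff, integral_add hai hbi, integral_add hfi hfi',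
      integral_add hki' hki'', integral_neg_eq_self f, integral_sub_right_eq_self k σ,
      integral_sub_left_eq_self k volume σ, hav, hbv, hfv, hkv]
    have hlog1 : 1 ≤ log (2 + r ^ 2) := by
      rw [le_log_iff_exp_le (by positivity)]
      nlinarith [exp_one_lt_d9]
    have hlog2 : log (1 + r ^ 4) ≤ 2 * log (2 + r ^ 2) := by
      rw [← Nat.cast_two, ← log_pow]
      exact log_le_log (by positivity) (by push_cast; nlinarith [sq_nonneg r])
    have hr34 : (r ^ 4)⁻¹ ≤ (r ^ 3)⁻¹ :=
      inv_anti₀ (by positivity) (pow_le_pow_right₀ hr (by norm_num))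
    have hr25 : r ^ 2 * (r ^ 5)⁻¹ = (r ^ 3)⁻¹ := by field_simp
    simp only [div_eq_mul_inv]
    have hi : 0 ≤ (r ^ 3)⁻¹ := by positivity
    have e1 := mul_le_mul_of_nonneg_right hlog1 hi
    have e2 := mul_le_mul_of_nonneg_right hlog2 hi
    linarith
  · refine le_trans ?_ (mul_le_mul_of_nonneg_left
      (add_le_add (add_le_add_right (hf_abs T) _) (hk_abs T)) hA)
    have hD := abs_nonneg (T - σ)
    set D := |T - σ| with hDdef
    set n := N T with hn
    have hn0 : 0 ≤ n := hN T
    rw [← div_eq_mul_inv, div_le_iff₀ (by positivity)]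
    set S := 1 + |T| * D with hS
    have hS1 : 1 ≤ S := le_add_of_nonneg_right (by positivity)
    have hup : ∀ {x S' : ℝ}, 0 ≤ S' → S' ≤ S → x ≤ a T + b T + f |T| + k D →
        A * x * S' ≤ A * (a T + b T + f |T| + k D) * S := by
      intro x S' hS'0 hS' hx
      refine mul_le_mul (mul_le_mul_of_nonneg_left hx hA) hS' hS'0 (mul_nonneg hA ?_)
      linarith [ha0 T, hb0 T, hf0 |T|, hk0 D]
    rcases le_total |T| 1 with hT | hT
    · have haT : a T = (r ^ 4)⁻¹ := Set.indicator_of_mem (Set.mem_Icc.2 (abs_le.1 hT)) _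
      have e1 : n ≤ A * (r ^ 4)⁻¹ := by
        rw [← div_eq_mul_inv, le_div_iff₀ (by positivity)]
        linarith [h2 T hT]
      calc n ≤ A * (r ^ 4)⁻¹ * 1 := by linarith
        _ ≤ A * (a T + b T + f |T| + k D) * S := by
          refine hup zero_le_one hS1 ?_
          rw [haT]
          linarith [hb0 T, hf0 |T|, hk0 D]
    set τ := √|T| with hτ
    have hτ2 : τ ^ 2 = |T| := Real.sq_sqrt (abs_nonneg T)
    have hτ0 : 0 < τ := Real.sqrt_pos.2 (by linarith)
    have h1T : n * τ ≤ A := h1 T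
    have h3T : r ^ 4 * n ≤ A * τ ^ 3 := by
      have := h3 T hT
      have hT2 : T ^ 2 = τ ^ 3 * τ := by rw [← sq_abs T, ← hτ2]; ring
      rw [hT2] at this
      refine le_of_mul_le_mul_right ?_ hτ0
      linarith
    rcases le_or_gt D (r ^ 2) with hDr | hDr
    · have hkD : k D = (r ^ 3)⁻¹ * ((r ^ 2)⁻¹ + D)⁻¹ :=
        Set.indicator_of_mem (Set.mem_Icc.2 ⟨hD, hDr⟩) _
      have e : n * r ≤ A ∧ n * r ^ 3 ≤ A * τ ^ 2 := by
        rcases le_total r τ with h | h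
        · have e1 : n * r ≤ n * τ := by gcongr
          refine ⟨e1.trans h1T, ?_⟩
          calc n * r ^ 3 = n * r * r ^ 2 := by ring
            _ ≤ A * τ ^ 2 := mul_le_mul (e1.trans h1T) (by gcongr) (by positivity) hA
        · have e1 : n * r ^ 3 ≤ A * τ ^ 2 := by
            refine le_of_mul_le_mul_right (a := r) ?_ hr0
            calc n * r ^ 3 * r = r ^ 4 * n := by ring
              _ ≤ A * τ ^ 2 * τ := by linarith
              _ ≤ A * τ ^ 2 * r := by gcongr
          refine ⟨le_of_mul_le_mul_right (a := r ^ 2) ?_ (by positivity), e1⟩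
          calc n * r * r ^ 2 = n * r ^ 3 := by ring
            _ ≤ A * τ ^ 2 := e1
            _ ≤ A * r ^ 2 := by gcongr
      have e3 : n ≤ A * ((r ^ 3)⁻¹ * ((r ^ 2)⁻¹ + D)⁻¹) * S := by
        rw [← mul_inv, ← div_eq_mul_inv, div_mul_eq_mul_div, le_div_iff₀ (by positivity)]
        have : n * (r ^ 3 * ((r ^ 2)⁻¹ + D)) = n * r + n * r ^ 3 * D := by field_simp
        rw [this, hS, ← hτ2, mul_add, mul_one, ← mul_assoc]
        exact add_le_add e.1 (mul_le_mul_of_nonneg_right e.2 hD)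
      refine e3.trans ?_
      refine hup (by linarith) le_rfl ?_
      rw [hkD]
      linarith [ha0 T, hb0 T, hf0 |T|]
    · have hSr : τ ^ 2 * r ^ 2 ≤ S := by
        rw [hτ2, hS]
        have : |T| * r ^ 2 ≤ |T| * D := by gcongr
        linarith
      rcases le_or_gt |T| (r ^ 2) with hTr | hTr
      · have hbT : b T = (r ^ 5)⁻¹ := Set.indicator_of_mem (Set.mem_Icc.2 (abs_le.1 hTr)) _
        have hτr : τ ≤ r := by
          rw [← hτ2] at hTr
          exact le_of_sq_le_sq hTr hr0.le
        have e1 : n ≤ A * (r ^ 5)⁻¹ * (τ ^ 2 * r ^ 2) := by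
          have : A * (r ^ 5)⁻¹ * (τ ^ 2 * r ^ 2) = A * τ ^ 2 * r / r ^ 4 := by field_simp
          rw [this, le_div_iff₀ (by positivity)]
          calc n * r ^ 4 ≤ A * τ ^ 2 * τ := by linarith
            _ ≤ A * τ ^ 2 * r := by gcongr
        refine e1.trans ?_
        refine hup (by positivity) hSr ?_
        rw [hbT]
        linarith [ha0 T, hf0 |T|, hk0 D]
      · have hfT : f |T| = (r ^ 2)⁻¹ * (τ ^ 3)⁻¹ := by
          rw [hf, Set.indicator_of_mem (Set.mem_Ioi.2 hTr), rpow_neg_three_halves (abs_nonneg T)]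
        have e1 : n ≤ A * ((r ^ 2)⁻¹ * (τ ^ 3)⁻¹) * (τ ^ 2 * r ^ 2) := by
          have : A * ((r ^ 2)⁻¹ * (τ ^ 3)⁻¹) * (τ ^ 2 * r ^ 2) = A / τ := by field_simp
          rwa [this, le_div_iff₀ hτ0]
        refine e1.trans ?_
        refine hup (by positivity) hSr ?_
        rw [hfT]
        linarith [ha0 T, hb0 T, hk0 D]

/-- A smooth cutoff equal to `1` on the range `[1, 17]` of `ω²` and vanishing outside
`(1/2, 35/2)`. -/
def bandCutoff : ℝ → ℝ :=
  (⟨8, 17 / 2, by norm_num, by norm_num⟩ : ContDiffBump (9 : ℝ))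

theorem contDiff_bandCutoff {n : ℕ∞} : ContDiff ℝ n bandCutoff :=
  ContDiffBump.contDiff _

theorem bandCutoff_eq_one {x : ℝ} (h1 : 1 ≤ x) (h17 : x ≤ 17) : bandCutoff x = 1 := by
  refine ContDiffBump.one_of_mem_closedBall _ ?_
  rw [Metric.mem_closedBall, Real.dist_eq, abs_le]
  constructor <;> simp only <;> linarith

theorem bandCutoff_eq_zero_of_le {x : ℝ} (h : x ≤ 1 / 2) : bandCutoff x = 0 := by
  refine ContDiffBump.zero_of_le_dist _ ?_
  rw [Real.dist_eq, le_abs]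
  right
  simp only
  linarith

theorem bandCutoff_eq_zero_of_ge {x : ℝ} (h : 35 / 2 ≤ x) : bandCutoff x = 0 := by
  refine ContDiffBump.zero_of_le_dist _ ?_
  rw [Real.dist_eq, le_abs]
  left
  simp only
  linarith

/-- The amplitude `2 y χ(y²)` arising from the substitution `A = y²`. -/
def sqAmplitude (y : ℝ) : ℝ := 2 * y * bandCutoff (y ^ 2)

theorem contDiff_sqAmplitude : ContDiff ℝ 3 sqAmplitude :=
  (contDiff_const.mul contDiff_id).mul (contDiff_bandCutoff.comp (contDiff_id.pow 2))

theorem sqAmplitude_eventuallyEq_zero : sqAmplitude =ᶠ[nhds 0] fun _ => 0 := by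
  have : ∀ᶠ y : ℝ in nhds 0, y ^ 2 < 1 / 2 :=
    ((continuous_pow 2).tendsto' (0 : ℝ) 0 (by norm_num)).eventually_lt_const (by norm_num)
  filter_upwards [this] with y hy
  rw [sqAmplitude, bandCutoff_eq_zero_of_le hy.le, mul_zero]

theorem sqAmplitude_eventuallyEq_five : sqAmplitude =ᶠ[nhds 5] fun _ => 0 := by
  have : ∀ᶠ y : ℝ in nhds 5, 35 / 2 < y ^ 2 :=
    ((continuous_pow 2).tendsto' (5 : ℝ) 25 (by norm_num)).eventually_const_lt (by norm_num)
  filter_upwards [this] with y hy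
  rw [sqAmplitude, bandCutoff_eq_zero_of_ge hy.le, mul_zero]

/-- The localized profile `χ(A) e^{iλ√A}`. -/
def sqrtWave (lam A : ℝ) : ℂ :=
  (bandCutoff A : ℂ) * Complex.exp (Complex.I * ((lam * √A : ℝ) : ℂ))

theorem contDiff_sqrtWave (lam : ℝ) {n : ℕ∞} : ContDiff ℝ n (sqrtWave lam) := by
  rw [contDiff_iff_contDiffAt]
  intro A
  rcases lt_or_ge 0 A with hA | hA
  · refine ContDiffAt.mul (Complex.ofRealCLM.contDiff.comp contDiff_bandCutoff).contDiffAt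
      (ContDiffAt.cexp (contDiffAt_const.mul ?_))
    exact Complex.ofRealCLM.contDiff.contDiffAt.comp A
      (contDiffAt_const.mul (Real.contDiffAt_sqrt hA.ne'))
  · have : sqrtWave lam =ᶠ[nhds A] fun _ => 0 := by
      filter_upwards [Iio_mem_nhds (show A < 1 / 2 by linarith)] with x hx
      rw [sqrtWave, bandCutoff_eq_zero_of_le (le_of_lt hx), Complex.ofReal_zero, zero_mul]
    exact contDiffAt_const.congr_of_eventuallyEq this

theorem support_sqrtWave_subset (lam : ℝ) : Function.support (sqrtWave lam) ⊆ Set.Ioc 0 25 := by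
  intro A hA
  by_contra h
  refine hA ?_
  rw [Set.mem_Ioc, not_and_or, not_lt, not_le] at h
  have : bandCutoff A = 0 := by
    rcases h with h | h
    · exact bandCutoff_eq_zero_of_le (by linarith)
    · exact bandCutoff_eq_zero_of_ge (by linarith)
  rw [sqrtWave, this, Complex.ofReal_zero, zero_mul]

theorem hasCompactSupport_sqrtWave (lam : ℝ) : HasCompactSupport (sqrtWave lam) :=
  HasCompactSupport.of_support_subset_isCompact isCompact_Icc
    ((support_sqrtWave_subset lam).trans Set.Ioc_subset_Icc_self)

open FourierTransform in
theorem integrable_fourier_sqrtWave (lam : ℝ) : Integrable (𝓕 (sqrtWave lam)) := by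
  have h := (𝓕 ((hasCompactSupport_sqrtWave lam).toSchwartzMap (contDiff_sqrtWave lam))).integrable
    (μ := volume)
  rwa [SchwartzMap.fourier_coe] at h

open FourierTransform in
theorem fourier_sqrtWave (lam w : ℝ) :
    𝓕 (sqrtWave lam) w = quadOsc sqAmplitude lam (4 * π * w) := by
  have hc : Continuous (sqrtWave lam) := (contDiff_sqrtWave lam (n := 0)).continuous
  have hsub := intervalIntegral.integral_deriv_smul_comp (a := 0) (b := 5)
    (f := fun y : ℝ => y ^ 2) (f' := fun y => 2 * y)
    (g := fun A => Complex.exp (↑(-2 * π * inner ℝ A w) * Complex.I) • sqrtWave lam A)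
    (fun y _ => (hasDerivAt_pow 2 y).congr_deriv (by norm_num)) (by fun_prop)
    (by simp only [Real.inner_apply]; fun_prop)
  have hsupp : Function.support (fun A : ℝ =>
      Complex.exp (↑(-2 * π * inner ℝ A w) * Complex.I) • sqrtWave lam A) ⊆ Set.Ioc 0 25 :=
    fun A hA => support_sqrtWave_subset lam fun h => hA (by simp only [h, smul_zero])
  rw [Real.fourier_eq', ← intervalIntegral.integral_eq_integral_of_support_subset
      (a := 0) (b := 25) hsupp]
  rw [show (0 : ℝ) ^ 2 = 0 by norm_num, show (5 : ℝ) ^ 2 = 25 by norm_num] at hsub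
  rw [← hsub, quadOsc]
  refine intervalIntegral.integral_congr fun y hy => ?_
  rw [Set.uIcc_of_le (by norm_num)] at hy
  simp only [Function.comp_apply, sqrtWave, sqAmplitude, Real.sqrt_sq hy.1, Real.inner_apply,
    smul_eq_mul, Complex.real_smul]
  have : Complex.exp (Complex.I * ((lam * y - 4 * π * w / 2 * y ^ 2 : ℝ) : ℂ)) =
      Complex.exp (((-2 * π * (y ^ 2 * w) : ℝ) : ℂ) * Complex.I) *
        Complex.exp (Complex.I * ((lam * y : ℝ) : ℂ)) := by
    rw [← Complex.exp_add]
    push_cast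
    ring_nf
  rw [this]
  push_cast
  ring

open FourierTransform in
/-- Fourier inversion for the localized profile, on the band where the cutoff is `1`. -/
theorem exp_sqrt_eq_integral (lam : ℝ) {A : ℝ} (h1 : 1 ≤ A) (h17 : A ≤ 17) :
    Complex.exp (Complex.I * ((lam * √A : ℝ) : ℂ)) =
      ∫ w : ℝ, 𝓕 (sqrtWave lam) w * Complex.exp (Complex.I * ((2 * π * w * A : ℝ) : ℂ)) := by
  have hc : Continuous (sqrtWave lam) := (contDiff_sqrtWave lam (n := 0)).continuous
  have h := congrFun (hc.fourierInv_fourier_eq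
    (hc.integrable_of_hasCompactSupport (hasCompactSupport_sqrtWave lam))
    (integrable_fourier_sqrtWave lam)) A
  rw [Real.fourierInv_eq', sqrtWave, bandCutoff_eq_one h1 h17, Complex.ofReal_one, one_mul] at h
  rw [← h]
  refine integral_congr_ae (ae_of_all _ fun w => ?_)
  simp only [Real.inner_apply, smul_eq_mul]
  rw [mul_comm, mul_comm Complex.I, mul_assoc (2 * π)]

theorem omegaKG_radicand_mem (x : Fin 4 → ℝ) :
    1 ≤ 1 + ∑ j : Fin 4, 2 * (1 - cos (x j)) ∧ 1 + ∑ j : Fin 4, 2 * (1 - cos (x j)) ≤ 17 := by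
  have h1 : ∀ j, 2 * (1 - cos (x j)) ≤ 4 := fun j => by linarith [neg_one_le_cos (x j)]
  have h2 : ∀ j, 0 ≤ 2 * (1 - cos (x j)) := fun j => by linarith [cos_le_one (x j)]
  constructor
  · linarith [Finset.sum_nonneg fun j (_ : j ∈ Finset.univ) => h2 j]
  · have := Finset.sum_le_sum fun j (_ : j ∈ Finset.univ) => h1 j
    simp only [Finset.sum_const, Finset.card_univ, Fintype.card_fin] at this
    norm_num at this ⊢
    linarith

theorem cube_eq_pi (d : ℕ) : cube d = Set.univ.pi fun _ => Set.Icc 0 (2 * π) := by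
  rw [Set.pi_univ_Icc]
  rfl

instance (d : ℕ) : IsFiniteMeasure (volume.restrict (cube d) : Measure (Fin d → ℝ)) :=
  isFiniteMeasure_restrict.2 isCompact_Icc.measure_ne_top

/-- Integrals of products of functions of one coordinate over the cube factorize. -/
theorem integral_cube_prod {d : ℕ} (f : Fin d → ℝ → ℂ) :
    ∫ x in cube d, ∏ j, f j (x j) = ∏ j, ∫ t in (0 : ℝ)..2 * π, f j t := by
  rw [cube_eq_pi, volume_pi, Measure.restrict_pi_pi, integral_fintype_prod_eq_prod]
  refine Finset.prod_congr rfl fun j _ => ?_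
  rw [integral_Icc_eq_integral_Ioc, intervalIntegral.integral_of_le two_pi_pos.le]

theorem norm_exp_I_mul_ofReal (t : ℝ) : ‖Complex.exp (Complex.I * (t : ℂ))‖ = 1 := by
  rw [mul_comm, Complex.norm_exp_ofReal_mul_I]

/-- A phase linear in `ω²` splits into one-dimensional factors. -/
theorem norm_integral_cube_exp (T lam : ℝ) (s : Fin 4 → ℝ) :
    ‖∫ x in cube 4, Complex.exp (Complex.I *
        ((T / 2 * (1 + ∑ j : Fin 4, 2 * (1 - cos (x j))) - lam * ∑ j, s j * x j : ℝ) : ℂ))‖ =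
      ∏ j, ‖∫ t in (0 : ℝ)..2 * π,
        Complex.exp (Complex.I * ((-T * cos t - lam * s j * t : ℝ) : ℂ))‖ := by
  have hone (z : ℂ) : ‖z‖ = ‖Complex.exp (Complex.I * ((T / 2 * 9 : ℝ) : ℂ)) * z‖ := by
    rw [norm_mul, norm_exp_I_mul_ofReal, one_mul]
  rw [← norm_prod, ← integral_cube_prod, hone (∫ x in cube 4, ∏ j, _), ← integral_const_mul]
  congr 2
  funext x
  rw [← Complex.exp_sum, ← Complex.exp_add]
  congr 1
  simp only [Fin.sum_univ_four]
  push_cast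
  ring

theorem prod_four_le (a : Fin 4 → ℝ) : ∏ j, a j ≤ 1 / 4 * ∑ j, a j ^ 4 := by
  simp only [Fin.prod_univ_four, Fin.sum_univ_four]
  nlinarith [sq_nonneg (a 0 * a 1 - a 2 * a 3), sq_nonneg (a 0 ^ 2 - a 1 ^ 2),
    sq_nonneg (a 2 ^ 2 - a 3 ^ 2)]

open FourierTransform in
/-- The oscillatory integral as a superposition of integrals with separable phase. -/
theorem oscIntJ_eq_integral (lam : ℝ) (s : Fin 4 → ℝ) :
    oscIntJ 4 lam s = ∫ w : ℝ, 𝓕 (sqrtWave lam) w * ∫ x in cube 4, Complex.exp (Complex.I *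
      ((4 * π * w / 2 * (1 + ∑ j : Fin 4, 2 * (1 - cos (x j))) -
        lam * ∑ j, s j * x j : ℝ) : ℂ)) := by
  have hsplit : ∀ x : Fin 4 → ℝ,
      Complex.exp (Complex.I * ((lam * (omegaKG 4 x - ∑ j : Fin 4, s j * x j) : ℝ) : ℂ)) =
        ∫ w : ℝ, 𝓕 (sqrtWave lam) w * Complex.exp (Complex.I *
          ((4 * π * w / 2 * (1 + ∑ j : Fin 4, 2 * (1 - cos (x j))) -
            lam * ∑ j, s j * x j : ℝ) : ℂ)) := by
    intro x
    have h := omegaKG_radicand_mem x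
    rw [mul_sub, sub_eq_add_neg, Complex.ofReal_add, mul_add, Complex.exp_add, omegaKG,
      exp_sqrt_eq_integral lam h.1 h.2, ← integral_mul_const]
    congr 1
    funext w
    rw [mul_assoc, ← Complex.exp_add, ← mul_add, ← Complex.ofReal_add]
    congr 4
    ring
  rw [oscIntJ, integral_congr_ae (ae_of_all _ hsplit), integral_integral_swap]
  · simp only [integral_const_mul]
  · have hi := (integrable_fourier_sqrtWave lam).comp_snd (volume.restrict (cube 4))
    refine hi.mul_bdd (c := 1) ?_ (ae_of_all _ fun p => ?_)
    · refine Continuous.aestronglyMeasurable ?_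
      fun_prop
    · exact (norm_exp_I_mul_ofReal _).le

open FourierTransform in
theorem exists_norm_oscIntJ_le : ∃ C, 0 ≤ C ∧ ∀ (r : ℝ), 1 ≤ r → ∀ s : Fin 4 → ℝ,
    ‖oscIntJ 4 (r ^ 2) s‖ ≤ C * (log (2 + r ^ 2) / r ^ 3) := by
  obtain ⟨A, hA, hdec⟩ := exists_quadOsc_decay contDiff_sqAmplitude
    sqAmplitude_eventuallyEq_zero.eq_of_nhds sqAmplitude_eventuallyEq_five.eq_of_nhds
    (by rw [sqAmplitude_eventuallyEq_zero.deriv_eq, deriv_const])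
    (by rw [sqAmplitude_eventuallyEq_five.deriv_eq, deriv_const])
  refine ⟨614400000 * A, by positivity, fun r hr s => ?_⟩
  have hmaj := exists_integrable_majorant hr hA (N := fun T => ‖quadOsc sqAmplitude (r ^ 2) T‖)
    (fun T => norm_nonneg _) (fun T => (hdec (r ^ 2) T).1)
    (fun T hT => by have := (hdec (r ^ 2) T).2.1 hT; rwa [← pow_mul] at this)
    (fun T hT => by have := (hdec (r ^ 2) T).2.2 hT; rwa [← pow_mul] at this)
  choose M hMi hMv hM using hmaj
  set G : ℝ → ℝ := fun T => 6400000 * ∑ j, (M (r ^ 2 * s j) T + M (-(r ^ 2 * s j)) T) with hG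
  have hpair : ∀ j, Integrable fun T => M (r ^ 2 * s j) T + M (-(r ^ 2 * s j)) T := fun j =>
    (hMi _).add (hMi _)
  have hGi : Integrable G := (integrable_finsetSum _ fun j _ => hpair j).const_mul _
  have hGv : ∫ T, G T ≤ 6400000 * (8 * (A * (12 * log (2 + r ^ 2) / r ^ 3))) := by
    rw [hG, integral_const_mul, integral_finsetSum _ fun j _ => hpair j]
    gcongr
    refine (Finset.sum_le_card_nsmul _ _ (2 * (A * (12 * log (2 + r ^ 2) / r ^ 3)))
      fun j _ => ?_).trans_eq ?_
    · rw [integral_add (hMi _) (hMi _)]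
      linarith [hMv (r ^ 2 * s j), hMv (-(r ^ 2 * s j))]
    · rw [Finset.card_univ, Fintype.card_fin, nsmul_eq_mul]
      push_cast
      ring
  have hbound : ∀ w : ℝ, ‖𝓕 (sqrtWave (r ^ 2)) w * ∫ x in cube 4, Complex.exp (Complex.I *
      ((4 * π * w / 2 * (1 + ∑ j : Fin 4, 2 * (1 - cos (x j))) -
        r ^ 2 * ∑ j, s j * x j : ℝ) : ℂ))‖ ≤ G (4 * π * w) := by
    intro w
    rw [norm_mul, norm_integral_cube_exp, fourier_sqrtWave]
    generalize 4 * π * w = T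
    refine (mul_le_mul_of_nonneg_left (prod_four_le _) (norm_nonneg _)).trans ?_
    simp only [hG]
    rw [mul_left_comm, Finset.mul_sum, Finset.mul_sum, Finset.mul_sum]
    refine Finset.sum_le_sum fun j _ => ?_
    have e1 := mul_le_mul_of_nonneg_left (norm_integral_exp_cos_pow_four_le T (r ^ 2 * s j))
      (norm_nonneg (quadOsc sqAmplitude (r ^ 2) T))
    have e2 := hM (r ^ 2 * s j) T
    have e3 := hM (-(r ^ 2 * s j)) T
    rw [sub_neg_eq_add] at e3
    linarith
  rw [oscIntJ_eq_integral]
  refine (norm_integral_le_of_norm_le (hGi.comp_mul_left' (R := 4 * π) (by positivity))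
    (ae_of_all _ hbound)).trans ?_
  rw [Measure.integral_comp_mul_left, smul_eq_mul]
  have hG0 : 0 ≤ ∫ T, G T := by
    refine integral_nonneg fun T => mul_nonneg (by norm_num) (Finset.sum_nonneg fun j _ => ?_)
    exact add_nonneg ((by positivity : (0 : ℝ) ≤ _).trans (hM _ T))
      ((by positivity : (0 : ℝ) ≤ _).trans (hM _ T))
  have hpi : |(4 * π)⁻¹| ≤ 1 := by
    rw [abs_of_pos (by positivity)]
    exact inv_le_one_of_one_le₀ (by linarith [pi_gt_three])
  calc |(4 * π)⁻¹| * ∫ T, G T ≤ 1 * ∫ T, G T := by gcongr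
    _ ≤ _ := by
      rw [one_mul]
      refine hGv.trans_eq ?_
      ring

theorem norm_oscIntJ_neg (d : ℕ) (lam : ℝ) (s : Fin d → ℝ) :
    ‖oscIntJ d (-lam) s‖ = ‖oscIntJ d lam s‖ := by
  rw [← RCLike.norm_conj (oscIntJ d lam s), oscIntJ, oscIntJ, ← integral_conj]
  congr 2
  funext x
  rw [← Complex.exp_conj, map_mul, Complex.conj_I, Complex.conj_ofReal, neg_mul,
    Complex.ofReal_neg]
  ring_nf

theorem norm_oscIntJ_le (d : ℕ) (lam : ℝ) (s : Fin d → ℝ) :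
    ‖oscIntJ d lam s‖ ≤ volume.real (cube d) := by
  have h := norm_setIntegral_le_of_norm_le_const (μ := volume) (s := cube d) (C := 1)
    (f := fun x => Complex.exp
      (Complex.I * ((lam * (omegaKG d x - ∑ j : Fin d, s j * x j) : ℝ) : ℂ)))
    isCompact_Icc.measure_lt_top fun x _ => (norm_exp_I_mul_ofReal _).le
  rwa [one_mul] at h

/-- Sharp decay of the oscillatory integral with the `d = 4` discrete Klein--Gordon
phase `Φ(x,s) = ω(x) − s·x`, uniformly in the velocity parameter `s`. -/
theorem oscillatory_decay_d4 :
    ∃ C > 0, ∀ (lam : ℝ) (s : Fin 4 → ℝ),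
      ‖oscIntJ 4 lam s‖ ≤ C * (1 + |lam|) ^ (-(3 : ℝ)/2) * Real.log (2 + |lam|) := by
  obtain ⟨C, hC, hdec⟩ := exists_norm_oscIntJ_le
  set V := volume.real (cube 4) with hV
  have hV0 : 0 ≤ V := measureReal_nonneg
  refine ⟨3 * C + 6 * V + 1, by positivity, fun lam s => ?_⟩
  have habs : ‖oscIntJ 4 lam s‖ = ‖oscIntJ 4 |lam| s‖ := by
    rcases abs_choice lam with h | h <;> rw [h]
    rw [norm_oscIntJ_neg]
  rw [habs]
  have ht := abs_nonneg lam
  set t := |lam| with htdef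
  rw [rpow_neg_three_halves (by positivity)]
  have hlog : 1 / 2 ≤ log (2 + t) := by
    have := log_le_log (by norm_num) (by linarith : (2 : ℝ) ≤ 2 + t)
    linarith [log_two_gt_d9]
  have hq0 : 0 < √(1 + t) := Real.sqrt_pos.2 (by positivity)
  rcases le_total t 1 with h1 | h1
  · have hq3 : 1 / 3 ≤ (√(1 + t) ^ 3)⁻¹ := by
      rw [one_div]
      refine inv_anti₀ (by positivity) ?_
      have hq : √(1 + t) ^ 2 ≤ 2 := by rw [Real.sq_sqrt (by positivity)]; linarith
      nlinarith
    calc ‖oscIntJ 4 t s‖ ≤ V := norm_oscIntJ_le 4 t s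
      _ ≤ (3 * C + 6 * V + 1) * (1 / 3) * (1 / 2) := by linarith
      _ ≤ _ := by gcongr
  · have hr : 1 ≤ √t := Real.one_le_sqrt.2 h1
    have hr2 : √t ^ 2 = t := Real.sq_sqrt ht
    have h := hdec (√t) hr s
    rw [hr2] at h
    have hcmp : √(1 + t) ^ 3 ≤ 3 * √t ^ 3 := by
      refine le_of_sq_le_sq ?_ (by positivity)
      calc (√(1 + t) ^ 3) ^ 2 = (1 + t) ^ 3 := by
            rw [← pow_mul, mul_comm 3, pow_mul, Real.sq_sqrt (by positivity)]
        _ ≤ (2 * t) ^ 3 := by gcongr; linarith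
        _ ≤ 9 * t ^ 3 := by nlinarith [pow_nonneg ht 3]
        _ = (3 * √t ^ 3) ^ 2 := by rw [mul_pow, ← pow_mul, mul_comm 3 2, pow_mul, hr2]; norm_num
    calc ‖oscIntJ 4 t s‖ ≤ C * (log (2 + t) / √t ^ 3) := h
      _ ≤ 3 * C * (√(1 + t) ^ 3)⁻¹ * log (2 + t) := by
        rw [mul_right_comm, ← div_eq_mul_inv, le_div_iff₀ (by positivity), mul_div_assoc',
          div_mul_eq_mul_div, div_le_iff₀ (by positivity)]
        have : 0 ≤ C * log (2 + t) := by positivity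
        linarith [mul_le_mul_of_nonneg_left hcmp this]
      _ ≤ _ := by gcongr; linarith
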